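/- Let n ≥ 1 and let w_0(i), w_1(i) ≥ 0 for i = 1,…,n. Suppose the 2n sub-wedge values are labeled so that n of them are 'type-m' and n are 'type-M', with every type-m value less than or equal to every type-M value. Then there exist a circular permutation σ* of {1,…,n} and an assignment t* ∈ {0,1}^n with SOP_{σ*,t*} = min over all (σ,t) of SOP_{σ,t}, such that each of the n angles θ_i in the drawing (σ*,t*) is the sum of one type-m sub-wedge and one type-M sub-wedge. -/

import Mathlib

/-- The cyclic successor `i ⊕ 1` in `Fin n`. -/
def cycSucc {n : ℕ} (i : Fin n) : Fin n :=
  ⟨(i.val + 1) % n, Nat.mod_lt _ (Nat.lt_of_le_of_lt (Nat.zero_le i.val) i.isLt)⟩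

/-- The sum of products of adjacent sub-wedges
`SOP_{σ,t} = ∑ i, w_{t'_i}(σ_i) · w_{t_{i⊕1}}(σ_{i⊕1})` of the balloon drawing given by
circular permutation `σ` and sub-wedge assignment `t` (a `Bool`, with `!t i` playing the
role of `t'_i = 1 − t_i`). -/
noncomputable def SOPwt {n : ℕ} (w : Fin n → Bool → ℝ) (σ : Equiv.Perm (Fin n))
    (t : Fin n → Bool) : ℝ :=
  ∑ i : Fin n, w (σ i) (!t i) * w (σ (cycSucc i)) (t (cycSucc i))

/-- Reversal of the segment `a, …, b` of `Fin n`, fixing everything else. -/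
def segRev {n : ℕ} (a b : ℕ) (hb : b < n) (k : Fin n) : Fin n :=
  if h : a ≤ k.val ∧ k.val ≤ b then ⟨a + b - k.val, by omega⟩ else k

theorem val_segRev {n : ℕ} (a b : ℕ) (hb : b < n) (k : Fin n) :
    (segRev a b hb k).val = if a ≤ k.val ∧ k.val ≤ b then a + b - k.val else k.val := by
  unfold segRev
  split_ifs <;> rfl

theorem segRev_involutive {n : ℕ} (a b : ℕ) (hb : b < n) :
    Function.Involutive (segRev a b hb) := by
  intro k
  apply Fin.ext
  simp only [val_segRev]
  split_ifs <;> omega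

theorem val_cycSucc {n : ℕ} (k : Fin n) :
    (cycSucc k).val = if k.val + 1 = n then 0 else k.val + 1 := by
  have hk := k.isLt
  unfold cycSucc
  split_ifs with h
  · simp [h]
  · exact Nat.mod_eq_of_lt (by omega)

theorem cycSucc_bijective {n : ℕ} : Function.Bijective (cycSucc : Fin n → Fin n) := by
  refine Finite.injective_iff_bijective.mp fun a b h => ?_
  have h' := congrArg Fin.val h
  have ha := a.isLt
  have hb := b.isLt
  simp only [val_cycSucc] at h'
  apply Fin.ext
  split_ifs at h' <;> omega

/-- Reversing the arc `i ⊕ 1, …, j` of a drawing replaces the angles at `i` and `j` by the angle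
made of their two left sub-wedges and the angle made of their two right sub-wedges. -/
theorem exists_reversal {n : ℕ} (σ : Equiv.Perm (Fin n)) (t : Fin n → Bool) {i j : Fin n}
    (hij : i < j) :
    ∃ (σ' : Equiv.Perm (Fin n)) (t' : Fin n → Bool),
      ∀ F : Fin n × Bool → Fin n × Bool → ℝ, (∀ p q, F p q = F q p) →
        ∑ k, F (σ' k, !t' k) (σ' (cycSucc k), t' (cycSucc k)) =
          ∑ k, F (σ k, !t k) (σ (cycSucc k), t (cycSucc k)) +
            (F (σ i, !t i) (σ j, !t j) +
              F (σ (cycSucc i), t (cycSucc i)) (σ (cycSucc j), t (cycSucc j)) -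
            F (σ i, !t i) (σ (cycSucc i), t (cycSucc i)) -
              F (σ j, !t j) (σ (cycSucc j), t (cycSucc j))) := by
  have hij' : i.val < j.val := hij
  have hj := j.isLt
  let r : Fin n → Fin n := segRev (i.val + 1) j.val hj
  let ρ : Fin n → Fin n := segRev (i.val + 1) (j.val - 1) (by omega)
  let c : Fin n → Prop := fun k => i.val + 1 ≤ k.val ∧ k.val ≤ j.val
  have hr : ∀ k, (r k).val = if c k then i.val + 1 + j.val - k.val else k.val :=
    val_segRev _ _ _
  have hρ : ∀ k, (ρ k).val =
      if i.val + 1 ≤ k.val ∧ k.val ≤ j.val - 1 then i.val + 1 + (j.val - 1) - k.val else k.val :=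
    val_segRev _ _ _
  classical
  let t' : Fin n → Bool := fun k => if c k then !t (r k) else t k
  refine ⟨(segRev_involutive (i.val + 1) j.val hj).toPerm.trans σ, t', fun F hF => ?_⟩
  have hσ' : ∀ k, ((segRev_involutive (i.val + 1) j.val hj).toPerm.trans σ) k = σ (r k) :=
    fun _ => rfl
  simp only [hσ']
  have h_out : ∀ k, ¬ c k → r k = k ∧ t' k = t k := fun k hk =>
    ⟨Fin.ext (by rw [hr, if_neg hk]), if_neg hk⟩
  have h_in : ∀ k, c k → t' k = !t (r k) := fun k hk => if_pos hk
  have h_succ := fun k : Fin n => val_cycSucc k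
  set G : Fin n → ℝ := fun k => F (σ k, !t k) (σ (cycSucc k), t (cycSucc k)) with hG
  set G' : Fin n → ℝ := fun k => F (σ (r k), !t' k) (σ (r (cycSucc k)), t' (cycSucc k)) with hG'
  have h_ci : c (cycSucc i) := by
    simp only [c, h_succ]; split_ifs <;> omega
  have h_cj : ¬ c (cycSucc j) := by
    simp only [c, h_succ]; split_ifs <;> omega
  have hi : G' i = F (σ i, !t i) (σ j, !t j) := by
    have h1 := h_out i (by simp only [c]; omega)
    have h2 : r (cycSucc i) = j := by
      apply Fin.ext
      rw [hr, if_pos h_ci, h_succ]; split_ifs <;> omega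
    simp only [hG', h_in _ h_ci, h1, h2]
  have hjj : G' j = F (σ (cycSucc i), t (cycSucc i)) (σ (cycSucc j), t (cycSucc j)) := by
    have hc : c j := ⟨hij', le_rfl⟩
    have h2 : r j = cycSucc i := by
      apply Fin.ext
      rw [hr, if_pos hc, h_succ]; split_ifs <;> omega
    simp only [hG', h_in _ hc, h_out _ h_cj, h2, Bool.not_not]
  have h_rest : ∀ k, k ≠ i → k ≠ j → G' k = G (ρ k) := by
    intro k hki hkj
    have hki' : k.val ≠ i.val := fun h => hki (Fin.ext h)
    have hkj' : k.val ≠ j.val := fun h => hkj (Fin.ext h)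
    have hk := k.isLt
    by_cases hc : c k
    · have hc' : i.val + 1 ≤ k.val ∧ k.val ≤ j.val := hc
      have hcs : c (cycSucc k) := by
        simp only [c, h_succ]; split_ifs <;> omega
      have hρk : (ρ k).val = i.val + 1 + (j.val - 1) - k.val := by
        rw [hρ, if_pos (by omega)]
      have h1 : r k = cycSucc (ρ k) := by
        apply Fin.ext
        rw [hr, if_pos hc, h_succ, hρk]; split_ifs <;> omega
      have h2 : r (cycSucc k) = ρ k := by
        apply Fin.ext
        rw [hr, if_pos hcs, h_succ, hρk]; split_ifs <;> omega
      simp only [hG', hG, h_in _ hc, h_in _ hcs, h1, h2, Bool.not_not]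
      exact hF _ _
    · have hc' : ¬ (i.val + 1 ≤ k.val ∧ k.val ≤ j.val) := hc
      have hcs : ¬ c (cycSucc k) := by
        simp only [c, h_succ]; split_ifs <;> omega
      have h1 : ρ k = k := by
        apply Fin.ext
        rw [hρ, if_neg (by omega)]
      simp only [hG', hG, h_out _ hc, h_out _ hcs, h1]
  have hρi : ρ i = i := Fin.ext (by rw [hρ, if_neg (by omega)])
  have hρj : ρ j = j := Fin.ext (by rw [hρ, if_neg (by omega)])
  have h_sum : ∑ k, (G' k - G (ρ k)) = (G' i - G i) + (G' j - G j) := by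
    rw [← Finset.sum_subset (Finset.subset_univ {i, j}), Finset.sum_pair hij.ne, hρi, hρj]
    intro k _ hk
    simp only [Finset.mem_insert, Finset.mem_singleton, not_or] at hk
    rw [h_rest k hk.1 hk.2, sub_self]
  have h_perm : ∑ k, G (ρ k) = ∑ k, G k :=
    (segRev_involutive (i.val + 1) (j.val - 1) (by omega)).bijective.sum_comp G
  rw [Finset.sum_sub_distrib, h_perm, hi, hjj] at h_sum
  linarith

/-- The sub-wedges met by the angles of a drawing are all the sub-wedges, once each. -/
theorem sum_angles {n : ℕ} (s : Fin n × Bool → ℝ) (σ : Equiv.Perm (Fin n)) (t : Fin n → Bool) :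
    ∑ k, (s (σ k, !t k) + s (σ (cycSucc k), t (cycSucc k))) = ∑ p, s p := by
  rw [Finset.sum_add_distrib, cycSucc_bijective.sum_comp fun k => s (σ k, t k),
    ← Finset.sum_add_distrib, Fintype.sum_prod_type,
    ← Equiv.sum_comp σ fun k => ∑ b, s (k, b)]
  refine Finset.sum_congr rfl fun k _ => ?_
  cases t k <;> simp [add_comm]

/-- If half of the sub-wedges have each type, a drawing with an angle of two equal types
has angles of both non-alternating kinds. -/
theorem exists_opposite_angles {n : ℕ} (τ : Fin n → Bool → Bool)
    (hcard : (Finset.univ.filter fun p : Fin n × Bool => τ p.1 p.2 = false).card = n)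
    (σ : Equiv.Perm (Fin n)) (t : Fin n → Bool)
    (h : ∃ i, τ (σ i) (!t i) = τ (σ (cycSucc i)) (t (cycSucc i))) (b : Bool) :
    ∃ i, τ (σ i) (!t i) = b ∧ τ (σ (cycSucc i)) (t (cycSucc i)) = b := by
  let s : Fin n × Bool → ℝ := fun p => if τ p.1 p.2 = b then 1 else -1
  have h_false : ∑ p : Fin n × Bool, (if τ p.1 p.2 = false then (1 : ℝ) else 0) = n := by
    rw [Finset.sum_boole, hcard]
  have h_zero : ∑ p, s p = 0 := by
    have h_card : ∑ _p : Fin n × Bool, (1 : ℝ) = 2 * n := by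
      simp [mul_comm]
    have h_eq : ∀ p, s p = (if b = false then 1 else -1) *
        (2 * (if τ p.1 p.2 = false then (1 : ℝ) else 0) - 1) := by
      intro p
      simp only [s]
      cases b <;> cases τ p.1 p.2 <;> norm_num
    simp only [h_eq]
    rw [← Finset.mul_sum, Finset.sum_sub_distrib, ← Finset.mul_sum, h_false, h_card, sub_self,
      mul_zero]
  rw [← sum_angles s σ t] at h_zero
  obtain ⟨i, hi⟩ := h
  obtain ⟨k, -, hk⟩ := Finset.exists_pos_of_sum_zero_of_exists_nonzero _ h_zero
    ⟨i, Finset.mem_univ i, by simp only [s, hi]; split_ifs <;> norm_num⟩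
  refine ⟨k, ?_⟩
  simp only [s] at hk
  split_ifs at hk with h1 h2 h2
  · exact ⟨h1, h2⟩
  all_goals norm_num at hk

/-- Observation 1 for SOP4: if the `2n` sub-wedges are labeled by `τ` with `n` of them of
type-m (`τ = false`) and `n` of type-M (`τ = true`), every type-m value being at most every
type-M value, then some drawing `(σ, t)` minimizing `SOP` has every angle made of one
type-m and one type-M sub-wedge. -/
theorem SOP4_alternating_optimum (n : ℕ) (hn : 1 ≤ n) (w : Fin n → Bool → ℝ)
    (hw : ∀ i b, 0 ≤ w i b) (τ : Fin n → Bool → Bool)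
    (hcard : (Finset.univ.filter fun p : Fin n × Bool => τ p.1 p.2 = false).card = n)
    (hsep : ∀ p q : Fin n × Bool, τ p.1 p.2 = false → τ q.1 q.2 = true →
      w p.1 p.2 ≤ w q.1 q.2) :
    ∃ (σ : Equiv.Perm (Fin n)) (t : Fin n → Bool),
      (∀ (σ' : Equiv.Perm (Fin n)) (t' : Fin n → Bool), SOPwt w σ t ≤ SOPwt w σ' t') ∧
      ∀ i : Fin n, τ (σ i) (!t i) ≠ τ (σ (cycSucc i)) (t (cycSucc i)) := by
  let N : Fin n × Bool → Fin n × Bool → ℝ := fun p q => if τ p.1 p.2 = τ q.1 q.2 then 1 else 0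
  let W : Fin n × Bool → Fin n × Bool → ℝ := fun p q => w p.1 p.2 * w q.1 q.2
  let cost : Equiv.Perm (Fin n) × (Fin n → Bool) → ℝ ×ₗ ℝ := fun d =>
    toLex (SOPwt w d.1 d.2,
      ∑ k, N (d.1 k, !d.2 k) (d.1 (cycSucc k), d.2 (cycSucc k)))
  obtain ⟨⟨σ, t⟩, hmin⟩ := Finite.exists_min cost
  refine ⟨σ, t, fun σ' t' => ?_, ?_⟩
  · rcases Prod.Lex.toLex_le_toLex.mp (hmin (σ', t')) with h | h
    · exact h.le
    · exact h.1.le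
  by_contra! h
  have key : ∀ i j b, i < j → τ (σ i) (!t i) = b → τ (σ (cycSucc i)) (t (cycSucc i)) = b →
      τ (σ j) (!t j) = !b → τ (σ (cycSucc j)) (t (cycSucc j)) = !b → False := by
    intro i j b hij h1 h2 h3 h4
    obtain ⟨σ', t', hF⟩ := exists_reversal σ t hij
    have hN := hF N fun p q => by simp only [N, eq_comm]
    have hW : SOPwt w σ' t' = SOPwt w σ t + _ := hF W fun p q => mul_comm _ _
    have hle : SOPwt w σ' t' ≤ SOPwt w σ t := by
      rw [hW]
      simp only [W]
      cases b
      · have e1 := hsep (σ i, !t i) (σ (cycSucc j), t (cycSucc j)) h1 h4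
        have e2 := hsep (σ (cycSucc i), t (cycSucc i)) (σ j, !t j) h2 h3
        nlinarith [mul_nonneg (sub_nonneg.mpr e1) (sub_nonneg.mpr e2)]
      · have e1 := hsep (σ (cycSucc j), t (cycSucc j)) (σ i, !t i) h4 h1
        have e2 := hsep (σ j, !t j) (σ (cycSucc i), t (cycSucc i)) h3 h2
        nlinarith [mul_nonneg (sub_nonneg.mpr e1) (sub_nonneg.mpr e2)]
    have hlt : ∑ k, N (σ' k, !t' k) (σ' (cycSucc k), t' (cycSucc k)) <
        ∑ k, N (σ k, !t k) (σ (cycSucc k), t (cycSucc k)) := by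
      have e : N (σ i, !t i) (σ j, !t j) +
          N (σ (cycSucc i), t (cycSucc i)) (σ (cycSucc j), t (cycSucc j)) -
          N (σ i, !t i) (σ (cycSucc i), t (cycSucc i)) -
          N (σ j, !t j) (σ (cycSucc j), t (cycSucc j)) = -2 := by
        simp only [N, h1, h2, h3, h4]
        cases b <;> norm_num
      linarith
    rcases Prod.Lex.toLex_le_toLex.mp (hmin (σ', t')) with h' | h'
    · exact absurd hle (not_le.mpr h')
    · exact absurd hlt (not_lt.mpr h'.2)
  obtain ⟨i, hi1, hi2⟩ := exists_opposite_angles τ hcard σ t h false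
  obtain ⟨j, hj1, hj2⟩ := exists_opposite_angles τ hcard σ t h true
  rcases lt_trichotomy i j with hij | hij | hij
  · exact key i j false hij hi1 hi2 hj1 hj2
  · subst hij
    simp [hi1] at hj1
  · exact key j i true hij hj1 hj2 hi1 hi2
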